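/- Let X ⊆ P^1 × P^n with n ≥ 2 be a finite set of points not having the inclusion property, such that the points of π_1(A_X) and of B_Y = π_1(B_X) are generic in P^n (every subset of π_1(A_X) ∪ B_Y has generic Hilbert function). Assume moreover Y_i ∩ Y_j ⊆ B_Y for all i ≠ j (distinct level sets project to sets meeting only inside B_Y). Then X is ACM if and only if N_1(X) ∈ D(X). -/

import Mathlib

noncomputable section

/-- Points of projective `m`-space over the field `k`. -/
abbrev Pt (k : Type) [Field k] (m : ℕ) := Projectivization k (Fin (m + 1) → k)

set_option synthInstance.maxHeartbeats 1000000 in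
/-- An ideal `I` of a polynomial ring defines an *arithmetically Cohen–Macaulay* (ACM)
quotient if there is a regular sequence on `R/I`, consisting of elements of the irrelevant
maximal ideal (generated by the images of the variables), whose length equals the Krull
dimension of `R/I`.  For a graded quotient of a polynomial ring this says exactly that the
depth of the irrelevant maximal ideal on `R/I` equals the Krull dimension, i.e. that `R/I`
is a Cohen–Macaulay ring. -/
def IsACM {k : Type} [Field k] {σ : Type} (I : Ideal (MvPolynomial σ k)) : Prop :=
  ∃ rs : List (MvPolynomial σ k ⧸ I),
    (∀ r ∈ rs,
      r ∈ Ideal.map (Ideal.Quotient.mk I)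
            (Ideal.span (Set.range (MvPolynomial.X : σ → MvPolynomial σ k)))) ∧
    RingTheory.Sequence.IsRegular (MvPolynomial σ k ⧸ I) rs ∧
    (rs.length : WithBot ℕ∞) = ringKrullDim (MvPolynomial σ k ⧸ I)

variable (k : Type) [Field k]

/-- The homogeneous (saturated) vanishing ideal of a set of points of `ℙ^m`:
all polynomials vanishing on the affine cone over the points. -/
def vanishP {m : ℕ} (Z : Set (Pt k m)) : Ideal (MvPolynomial (Fin (m + 1)) k) :=
  ⨅ (q : Pt k m) (_ : q ∈ Z) (s : k),
    RingHom.ker (MvPolynomial.eval (s • q.rep))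

/-- The bihomogeneous (saturated) vanishing ideal of a set of points of `ℙ^a × ℙ^b`:
all polynomials vanishing on the multicone over the points. -/
def vanishP2 {a b : ℕ} (X : Set (Pt k a × Pt k b)) :
    Ideal (MvPolynomial (Fin (a + 1) ⊕ Fin (b + 1)) k) :=
  ⨅ (p : Pt k a × Pt k b) (_ : p ∈ X) (s : k) (t : k),
    RingHom.ker (MvPolynomial.eval (Sum.elim (s • p.1.rep) (t • p.2.rep)))

/-- The `(⋆)`-property for a finite set of points in `ℙ^a × ℙ^b`. -/
def StarProp {a b : ℕ} (X : Set (Pt k a × Pt k b)) : Prop :=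
  ∀ p ∈ X, ∀ q ∈ X, (p.1, q.2) ∈ X ∨ (q.1, p.2) ∈ X

/-- The Hilbert function of the quotient by an ideal `I` of a polynomial ring:
`i ↦ dim_k S_i − dim_k (I ∩ S_i)`. -/
def hilbFn {σ : Type} (I : Ideal (MvPolynomial σ k)) (i : ℕ) : ℕ :=
  Module.finrank k (MvPolynomial.homogeneousSubmodule σ k i) -
  Module.finrank k
    ((Submodule.restrictScalars k I ⊓ MvPolynomial.homogeneousSubmodule σ k i :
      Submodule k (MvPolynomial σ k)))

/-- A set of points of `ℙ^m` has generic Hilbert function: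
`H_Z(i) = min (C(i+m,m), #Z)` for all `i`. -/
def GenericHF {m : ℕ} (Z : Set (Pt k m)) : Prop :=
  ∀ i : ℕ, hilbFn k (vanishP k Z) i = min (Nat.choose (i + m) m) Z.ncard

/-- The image in `ℙ^n` of the level set of `X ⊆ ℙ^1 × ℙ^n` over the point `P ∈ ℙ^1`;
this is the set `Y_i = π₁(X_i)` when `P = P_i` is in the image of the first projection. -/
def levelImage {n : ℕ} (X : Set (Pt k 1 × Pt k n)) (P : Pt k 1) : Set (Pt k n) :=
  {q | (P, q) ∈ X}

/-- `X ⊆ ℙ^1 × ℙ^n` has the *inclusion property*: the images `Y_1, …, Y_t` of its level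
sets are totally ordered by inclusion. -/
def InclusionProp {n : ℕ} (X : Set (Pt k 1 × Pt k n)) : Prop :=
  ∀ P₁ P₂ : Pt k 1,
    levelImage k X P₁ ⊆ levelImage k X P₂ ∨ levelImage k X P₂ ⊆ levelImage k X P₁

/-- `B_Y ⊆ ℙ^n`: the points lying in the image of every level set of `X`,
i.e. `B_Y = ⋂ᵢ Y_i`. -/
def BY {n : ℕ} (X : Set (Pt k 1 × Pt k n)) : Set (Pt k n) :=
  {q | ∀ P ∈ Prod.fst '' X, (P, q) ∈ X}

/-- `B_X`: the points `P × Q` of `X` with `Q ∈ ⋂ᵢ Y_i`. -/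
def BX {n : ℕ} (X : Set (Pt k 1 × Pt k n)) : Set (Pt k 1 × Pt k n) :=
  {p ∈ X | p.2 ∈ BY k X}

/-- `A_X = X \ B_X`. -/
def AX {n : ℕ} (X : Set (Pt k 1 × Pt k n)) : Set (Pt k 1 × Pt k n) :=
  X \ BX k X

/-- `N₀(X) = #π₁(A_X)`. -/
def N0 {n : ℕ} (X : Set (Pt k 1 × Pt k n)) : ℕ := (Prod.snd '' AX k X).ncard

/-- `N₁(X) = #π₁(B_X)`. -/
def N1 {n : ℕ} (X : Set (Pt k 1 × Pt k n)) : ℕ := (Prod.snd '' BX k X).ncard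

/-- `𝒟(X) = ⋃_{i ∈ ℤ} {C(N₀(X)+i, n), C(N₀(X)+i, n)+1, …, C(N₀(X)+i+1, n) − N₀(X)}`
(written with `j = N₀(X) + i`). -/
def DX {n : ℕ} (X : Set (Pt k 1 × Pt k n)) : Set ℕ :=
  {m | ∃ j : ℕ, Nat.choose j n ≤ m ∧ m + N0 k X ≤ Nat.choose (j + 1) n}

section EvalScaling

open MvPolynomial

variable {k} {σ : Type} (w : σ → ℕ) (v : σ → k)

/-- The restriction of `f` to the weighted line `t ↦ (t ^ w i * v i)_i`. -/
def weightedLine (f : MvPolynomial σ k) : Polynomial k :=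
  aeval (fun i => Polynomial.C (v i) * Polynomial.X ^ w i) f

lemma eval_weightedLine (f : MvPolynomial σ k) (t : k) :
    (weightedLine w v f).eval t = eval (fun i => t ^ w i * v i) f := by
  rw [weightedLine, ← Polynomial.coe_evalRingHom, ← MvPolynomial.coe_aeval_eq_eval]
  induction f using MvPolynomial.induction_on with
  | C a => simp
  | add p q hp hq => simp only [map_add, hp, hq]
  | mul_X p i hp =>
    simp only [map_mul, hp, aeval_X]
    simp [mul_comm]

lemma coeff_weightedLine (f : MvPolynomial σ k) (m : ℕ) :
    (weightedLine w v f).coeff m = eval v (weightedHomogeneousComponent w m f) := by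
  classical
  induction f using MvPolynomial.induction_on' with
  | monomial d a =>
    have h : weightedLine w v (monomial d a) =
        Polynomial.C (eval v (monomial d a)) * Polynomial.X ^ Finsupp.weight w d := by
      rw [weightedLine, aeval_monomial, eval_monomial, Finsupp.weight_apply]
      simp only [mul_pow, Finsupp.prod, Finset.prod_mul_distrib, Finsupp.sum, map_mul, map_prod,
        map_pow, ← pow_mul, Finset.prod_pow_eq_pow_sum, smul_eq_mul, mul_comm (w _)]
      rw [← mul_assoc]
      rfl
    rw [h, Polynomial.coeff_C_mul_X_pow]
    have hm := isWeightedHomogeneous_monomial w d a rfl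
    split_ifs with hmd
    · rw [hmd, hm.weightedHomogeneousComponent_same]
    · rw [hm.weightedHomogeneousComponent_ne m hmd, map_zero]
  | add p q hp hq =>
    rw [weightedLine] at *
    rw [map_add, Polynomial.coeff_add, hp, hq, map_add, map_add]

lemma MvPolynomial.IsWeightedHomogeneous.eval_scale {f : MvPolynomial σ k} {d : ℕ}
    (hf : f.IsWeightedHomogeneous w d) (t : k) :
    eval (fun i => t ^ w i * v i) f = t ^ d * eval v f := by
  rw [← eval_weightedLine]
  have : weightedLine w v f = Polynomial.C (eval v f) * Polynomial.X ^ d := by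
    ext m
    rw [coeff_weightedLine, Polynomial.coeff_C_mul_X_pow]
    split_ifs with hmd
    · rw [hmd, hf.weightedHomogeneousComponent_same]
    · rw [hf.weightedHomogeneousComponent_ne m hmd, map_zero]
  rw [this, Polynomial.eval_mul, Polynomial.eval_C, Polynomial.eval_X_pow, mul_comm]

lemma MvPolynomial.IsHomogeneous.eval_smul' {f : MvPolynomial σ k} {d : ℕ}
    (hf : f.IsHomogeneous d) (t : k) : eval (t • v) f = t ^ d * eval v f := by
  rw [← IsWeightedHomogeneous.eval_scale 1 v hf t]
  congr 2
  ext i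
  simp

lemma eval_aeval_eq {τ : Type} (g : σ → MvPolynomial τ k) (y : τ → k) (f : MvPolynomial σ k) :
    eval y (aeval g f) = eval (fun i => eval y (g i)) f := by
  induction f using MvPolynomial.induction_on with
  | C r => simp
  | add f g hf hg => simp only [map_add, hf, hg]
  | mul_X f i hf => simp only [map_mul, hf, aeval_X, eval_X]

end EvalScaling

section GenericPoints

open MvPolynomial Module

variable {k} {m : ℕ}

/-- Evaluation of forms of degree `d` at the representatives of the points of `Z`. -/
def evalForms (Z : Set (Pt k m)) (d : ℕ) :
    homogeneousSubmodule (Fin (m + 1)) k d →ₗ[k] (Z → k) :=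
  LinearMap.pi fun q => (aeval (R := k) q.1.rep).toLinearMap ∘ₗ Submodule.subtype _

lemma evalForms_apply (Z : Set (Pt k m)) (d : ℕ)
    (f : homogeneousSubmodule (Fin (m + 1)) k d) (q : Z) :
    evalForms Z d f q = eval q.1.rep f.1 := by
  simp [evalForms]

lemma mem_vanishP {Z : Set (Pt k m)} {f : MvPolynomial (Fin (m + 1)) k} :
    f ∈ vanishP k Z ↔ ∀ q ∈ Z, ∀ s : k, eval (s • q.rep) f = 0 := by
  simp [vanishP, Submodule.mem_iInf, RingHom.mem_ker]

lemma mem_ker_evalForms (Z : Set (Pt k m)) (d : ℕ) (f : homogeneousSubmodule (Fin (m + 1)) k d) :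
    f ∈ LinearMap.ker (evalForms Z d) ↔ f.1 ∈ vanishP k Z := by
  rw [mem_vanishP, LinearMap.mem_ker]
  constructor
  · intro h q hq s
    rw [(show f.1.IsHomogeneous d from f.2).eval_smul', ← evalForms_apply Z d f ⟨q, hq⟩, h]
    simp
  · intro h
    ext q
    rw [evalForms_apply]
    simpa using h q.1 q.2 1

instance (d : ℕ) : Module.Finite k (homogeneousSubmodule (Fin (m + 1)) k d) :=
  Module.Finite.iff_fg.2 (homogeneousSubmodule_fg _ _ d)

lemma hilbFn_eq_finrank_range (Z : Set (Pt k m)) (d : ℕ) :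
    hilbFn k (vanishP k Z) d = finrank k (LinearMap.range (evalForms Z d)) := by
  have hker : finrank k (LinearMap.ker (evalForms Z d)) =
      finrank k ((Submodule.restrictScalars k (vanishP k Z) ⊓ homogeneousSubmodule _ k d :
        Submodule k (MvPolynomial (Fin (m + 1)) k))) := by
    have : (LinearMap.ker (evalForms Z d)).map (Submodule.subtype _) =
        Submodule.restrictScalars k (vanishP k Z) ⊓ homogeneousSubmodule _ k d := by
      ext f
      simp only [Submodule.mem_map, mem_ker_evalForms, Submodule.mem_inf]
      constructor
      · rintro ⟨g, hg, rfl⟩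
        exact ⟨hg, g.2⟩
      · rintro ⟨h1, h2⟩
        exact ⟨⟨f, h2⟩, h1, rfl⟩
    rw [← this]
    exact (LinearEquiv.finrank_eq (Submodule.equivSubtypeMap _ _))
  have := LinearMap.finrank_range_add_finrank_ker (evalForms Z d)
  rw [hilbFn, ← hker]
  omega

/-- If `Z` is generic and imposes at most `dim S_d` conditions, forms of degree `d` take arbitrary
values on `Z`. -/
lemma GenericHF.exists_form {Z : Set (Pt k m)} (hZ : GenericHF k Z) (hfin : Z.Finite) {d : ℕ}
    (hd : Z.ncard ≤ (d + m).choose m) (c : Pt k m → k) :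
    ∃ u : MvPolynomial (Fin (m + 1)) k, u.IsHomogeneous d ∧ ∀ q ∈ Z, eval q.rep u = c q := by
  have := hfin.fintype
  have h := hZ d
  rw [min_eq_right hd, hilbFn_eq_finrank_range] at h
  have htop : LinearMap.range (evalForms Z d) = ⊤ := by
    apply Submodule.eq_top_of_finrank_eq
    rw [h, finrank_fintype_fun_eq_card, Set.ncard_eq_toFinset_card', Set.toFinset_card]
  obtain ⟨u, hu⟩ := LinearMap.range_eq_top.1 htop (fun q => c q.1)
  refine ⟨u.1, u.2, fun q hq => ?_⟩
  rw [← evalForms_apply Z d u ⟨q, hq⟩, hu]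

/-- If `Z ⊆ W` are generic and `Z` has at least `dim S_d` points, a form of degree `d` vanishing
on `Z` vanishes on `W`. -/
lemma GenericHF.eval_eq_zero_of_subset {Z W : Set (Pt k m)} (hZ : GenericHF k Z)
    (hW : GenericHF k W) (hfin : W.Finite) (hZW : Z ⊆ W) {d : ℕ}
    (hd : (d + m).choose m ≤ Z.ncard) {u : MvPolynomial (Fin (m + 1)) k} (hu : u.IsHomogeneous d)
    (h0 : ∀ q ∈ Z, eval q.rep u = 0) : ∀ q ∈ W, eval q.rep u = 0 := by
  have hZd := hZ d
  have hWd := hW d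
  rw [min_eq_left hd, hilbFn_eq_finrank_range] at hZd
  rw [min_eq_left (hd.trans (Set.ncard_le_ncard hZW hfin)), hilbFn_eq_finrank_range] at hWd
  have h1 := LinearMap.finrank_range_add_finrank_ker (evalForms Z d)
  have h2 := LinearMap.finrank_range_add_finrank_ker (evalForms W d)
  have hle : LinearMap.ker (evalForms W d) ≤ LinearMap.ker (evalForms Z d) := by
    intro f hf
    rw [mem_ker_evalForms, mem_vanishP] at hf ⊢
    exact fun q hq => hf q (hZW hq)
  have heq := Submodule.eq_of_le_of_finrank_eq hle (by omega)
  have hmem : (⟨u, hu⟩ : homogeneousSubmodule (Fin (m + 1)) k d) ∈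
      LinearMap.ker (evalForms Z d) := by
    rw [LinearMap.mem_ker]
    ext q
    rw [evalForms_apply]
    exact h0 q.1 q.2
  rw [← heq, LinearMap.mem_ker] at hmem
  intro q hq
  rw [← evalForms_apply W d ⟨u, hu⟩ ⟨q, hq⟩, hmem]
  rfl

end GenericPoints

section Multicone

open MvPolynomial

variable {k}

/-- The linear form on `ℙ^1` vanishing exactly at `P`. -/
def pointForm (τ : Type) (P : Pt k 1) : MvPolynomial (Fin (1 + 1) ⊕ τ) k :=
  C (P.rep 0) * X (Sum.inl 1) - C (P.rep 1) * X (Sum.inl 0)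

lemma eval_pointForm {τ : Type} (P P' : Pt k 1) (s : k) (y : τ → k) :
    eval (Sum.elim (s • P'.rep) y) (pointForm τ P) =
      s * (P.rep 0 * P'.rep 1 - P.rep 1 * P'.rep 0) := by
  simp only [pointForm, map_sub, map_mul, eval_C, eval_X, Sum.elim_inl, Pi.smul_apply, smul_eq_mul]
  ring

lemma eq_of_det_eq_zero {P P' : Pt k 1} (h : P.rep 0 * P'.rep 1 - P.rep 1 * P'.rep 0 = 0) :
    P = P' := by
  rw [← P.mk_rep, ← P'.mk_rep, Projectivization.mk_eq_mk_iff']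
  have hne := P'.rep_nonzero
  by_cases h0 : P'.rep 0 = 0
  · have h1 : P'.rep 1 ≠ 0 := by
      intro h1
      apply hne
      ext i
      fin_cases i <;> simp [h0, h1]
    refine ⟨P.rep 1 / P'.rep 1, ?_⟩
    ext i
    fin_cases i
    · simp only [Fin.zero_eta, Pi.smul_apply, smul_eq_mul]
      field_simp
      linear_combination -h
    · simp only [Fin.mk_one, Pi.smul_apply, smul_eq_mul]
      field_simp
  · refine ⟨P.rep 0 / P'.rep 0, ?_⟩
    ext i
    fin_cases i
    · simp only [Fin.zero_eta, Pi.smul_apply, smul_eq_mul]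
      field_simp
    · simp only [Fin.mk_one, Pi.smul_apply, smul_eq_mul]
      field_simp
      linear_combination h

/-- A form of degree `#T - [P ∈ T]` on `ℙ^1` vanishing at the points of `T` other than `P`, but
not at `P`. -/
lemma exists_separator (τ : Type) (T : Finset (Pt k 1)) (P : Pt k 1) :
    ∃ (L : MvPolynomial (Fin (1 + 1) ⊕ τ) k) (b : ℕ) (c : k), c ≠ 0 ∧
      (∀ (s : k) (y : τ → k), eval (Sum.elim (s • P.rep) y) L = s ^ b * c) ∧
      ∀ P' ∈ T, P' ≠ P → ∀ (s : k) (y : τ → k), eval (Sum.elim (s • P'.rep) y) L = 0 := by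
  classical
  refine ⟨∏ P' ∈ T.erase P, pointForm τ P', (T.erase P).card,
    ∏ P' ∈ T.erase P, (P'.rep 0 * P.rep 1 - P'.rep 1 * P.rep 0), ?_, ?_, ?_⟩
  · rw [Finset.prod_ne_zero_iff]
    exact fun P' hP' h => Finset.ne_of_mem_erase hP' (eq_of_det_eq_zero h)
  · intro s y
    rw [map_prod]
    simp only [eval_pointForm, Finset.prod_mul_distrib, Finset.prod_const]
  · intro P' hP' hne s y
    rw [map_prod]
    apply Finset.prod_eq_zero (Finset.mem_erase.2 ⟨hne, hP'⟩)
    rw [eval_pointForm]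
    ring

/-- Over an infinite field, a linear form can be chosen to avoid finitely many nonzero vectors. -/
lemma exists_linear_form_ne_zero [Infinite k] {m : ℕ} {T : Set (Pt k m)} (hT : T.Finite) :
    ∃ c : Fin (m + 1) → k, ∀ q ∈ T, ∑ i, c i * q.rep i ≠ 0 := by
  have := hT.fintype
  classical
  have hne : (∏ q ∈ T.toFinset, ∑ i, C (q.rep i) * X i : MvPolynomial (Fin (m + 1)) k) ≠ 0 := by
    rw [Finset.prod_ne_zero_iff]
    intro q _ h
    apply q.rep_nonzero
    ext i
    have := congrArg (eval (Pi.single i 1)) h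
    simpa [Pi.single_apply] using this
  obtain ⟨c, hc⟩ : ∃ c, eval c
      (∏ q ∈ T.toFinset, ∑ i, C (q.rep i) * X i : MvPolynomial (Fin (m + 1)) k) ≠ 0 := by
    by_contra! h
    exact hne (MvPolynomial.funext fun c => by rw [h c, map_zero])
  refine ⟨c, fun q hq h => hc ?_⟩
  rw [map_prod]
  apply Finset.prod_eq_zero (Set.mem_toFinset.2 hq)
  simpa [mul_comm] using h

variable {a b : ℕ}

lemma mem_vanishP2 {X : Set (Pt k a × Pt k b)}
    {f : MvPolynomial (Fin (a + 1) ⊕ Fin (b + 1)) k} :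
    f ∈ vanishP2 k X ↔ ∀ P Q, (P, Q) ∈ X → ∀ s t : k,
      eval (Sum.elim (s • P.rep) (t • Q.rep)) f = 0 := by
  simp [vanishP2, Submodule.mem_iInf, RingHom.mem_ker]

lemma vanishP2_eq_iInf (X : Set (Pt k a × Pt k b)) :
    vanishP2 k X = ⨅ p : X, vanishP2 k {p.1} := by
  ext f
  simp only [Submodule.mem_iInf, mem_vanishP2, Set.mem_singleton_iff, Subtype.forall]
  constructor
  · rintro h p hp P Q rfl
    exact h P Q hp
  · exact fun h P Q hPQ => h (P, Q) hPQ P Q rfl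

/-- A polynomial vanishing at the points `s • v` with `s ≠ 0` also vanishes at `s = 0`. -/
lemma eval_eq_zero_of_forall_ne_zero [Infinite k] {τ : Type}
    {f : MvPolynomial (Fin (a + 1) ⊕ τ) k} {v : Fin (a + 1) → k} {y : τ → k}
    (h : ∀ s : k, s ≠ 0 → eval (Sum.elim (s • v) y) f = 0) (s : k) :
    eval (Sum.elim (s • v) y) f = 0 := by
  have hs : ∀ s : k, eval (Sum.elim (s • v) y) f =
      (weightedLine (Sum.elim 1 0) (Sum.elim v y) f).eval s := by
    intro s
    rw [eval_weightedLine]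
    congr 2
    ext (i | i) <;> simp
  have : Polynomial.X * weightedLine (Sum.elim 1 0) (Sum.elim v y) f = 0 := by
    apply Polynomial.funext
    intro s
    rw [Polynomial.eval_mul, ← hs, Polynomial.eval_X, Polynomial.eval_zero]
    by_cases h0 : s = 0
    · rw [h0, zero_mul]
    · rw [h s h0, mul_zero]
  rw [hs, (mul_eq_zero.1 this).resolve_left Polynomial.X_ne_zero, Polynomial.eval_zero]

/-- The coordinate ring of the multicone over a point is a polynomial ring in two variables. -/
def multiconeHom (p : Pt k a × Pt k b) :
    MvPolynomial (Fin (a + 1) ⊕ Fin (b + 1)) k →ₐ[k] MvPolynomial (Fin 2) k :=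
  aeval (Sum.elim (fun i => C (p.1.rep i) * X 0) (fun i => C (p.2.rep i) * X 1))

lemma multiconeHom_surjective (p : Pt k a × Pt k b) : Function.Surjective (multiconeHom p) := by
  obtain ⟨i, hi⟩ := Function.ne_iff.1 p.1.rep_nonzero
  obtain ⟨j, hj⟩ := Function.ne_iff.1 p.2.rep_nonzero
  rw [← AlgHom.range_eq_top, eq_top_iff, ← MvPolynomial.adjoin_range_X, Algebra.adjoin_le_iff]
  rintro _ ⟨l, rfl⟩
  fin_cases l
  · refine ⟨C (p.1.rep i)⁻¹ * X (Sum.inl i), ?_⟩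
    simp only [multiconeHom, AlgHom.toRingHom_eq_coe, RingHom.coe_coe, map_mul, aeval_X, aeval_C,
      Sum.elim_inl, Fin.zero_eta]
    rw [algebraMap_eq, ← mul_assoc, ← C_mul,
      inv_mul_cancel₀ hi, C_1, one_mul]
  · refine ⟨C (p.2.rep j)⁻¹ * X (Sum.inr j), ?_⟩
    simp only [multiconeHom, AlgHom.toRingHom_eq_coe, RingHom.coe_coe, map_mul, aeval_X, aeval_C,
      Sum.elim_inr, Fin.mk_one]
    rw [algebraMap_eq, ← mul_assoc, ← C_mul,
      inv_mul_cancel₀ hj, C_1, one_mul]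

lemma eval_multiconeHom (p : Pt k a × Pt k b)
    (f : MvPolynomial (Fin (a + 1) ⊕ Fin (b + 1)) k) (c : Fin 2 → k) :
    eval c (multiconeHom p f) = eval (Sum.elim (c 0 • p.1.rep) (c 1 • p.2.rep)) f := by
  rw [multiconeHom, eval_aeval_eq]
  congr 2
  ext (i | i) <;> simp [mul_comm]

lemma ker_multiconeHom [Infinite k] (p : Pt k a × Pt k b) :
    RingHom.ker (multiconeHom p) = vanishP2 k {p} := by
  ext f
  rw [RingHom.mem_ker, mem_vanishP2]
  constructor
  · rintro h P Q hPQ s t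
    have := eval_multiconeHom p f ![s, t]
    rw [h, map_zero] at this
    rw [Set.mem_singleton_iff] at hPQ
    subst hPQ
    simpa using this.symm
  · intro h
    apply MvPolynomial.funext
    intro c
    rw [eval_multiconeHom, map_zero]
    exact h p.1 p.2 rfl _ _

lemma ringKrullDim_quotient_vanishP2_singleton [Infinite k] (p : Pt k a × Pt k b) :
    ringKrullDim (MvPolynomial (Fin (a + 1) ⊕ Fin (b + 1)) k ⧸ vanishP2 k {p}) = 2 := by
  rw [← ker_multiconeHom, ringKrullDim_eq_of_ringEquiv
    (Ideal.quotientKerAlgEquivOfSurjective (multiconeHom_surjective p)).toRingEquiv,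
    MvPolynomial.ringKrullDim_of_isNoetherianRing, ringKrullDim_eq_zero_of_field]
  simp

/-- The dimension of a quotient by a finite intersection of ideals is bounded by that of the
quotients by the single ideals. -/
lemma ringKrullDim_quotient_iInf_le {R ι : Type*} [CommRing R] [Finite ι] (p : ι → Ideal R)
    {d : WithBot ℕ∞} (h : ∀ i, ringKrullDim (R ⧸ p i) ≤ d) :
    ringKrullDim (R ⧸ ⨅ i, p i) ≤ d := by
  have := Fintype.ofFinite ι
  rw [ringKrullDim_quotient, Order.krullDim]
  refine iSup_le fun l => ?_
  have hhead : (⨅ i, p i) ≤ l.head.1.asIdeal := l.head.2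
  obtain ⟨i, hi⟩ : ∃ i, p i ≤ l.head.1.asIdeal := by
    have := (Ideal.IsPrime.inf_le' (s := Finset.univ) (f := p) l.head.1.isPrime).1
      (by rwa [Finset.inf_univ_eq_iInf])
    simpa using this
  refine le_trans ?_ (h i)
  rw [ringKrullDim_quotient]
  let l' : LTSeries (PrimeSpectrum.zeroLocus (p i : Set R)) :=
    { length := l.length
      toFun := fun j => ⟨(l j).1, fun x hx => LTSeries.head_le l j (hi hx)⟩
      step := fun j => l.step j }
  exact le_iSup (fun l : LTSeries (PrimeSpectrum.zeroLocus (p i : Set R)) =>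
    (l.length : WithBot ℕ∞)) l'

lemma ringKrullDim_quotient_vanishP2 [Infinite k] {X : Set (Pt k a × Pt k b)} (hfin : X.Finite)
    (hne : X.Nonempty) :
    ringKrullDim (MvPolynomial (Fin (a + 1) ⊕ Fin (b + 1)) k ⧸ vanishP2 k X) = 2 := by
  have := hfin.to_subtype
  apply le_antisymm
  · rw [vanishP2_eq_iInf]
    exact ringKrullDim_quotient_iInf_le _
      fun p => (ringKrullDim_quotient_vanishP2_singleton p.1).le
  · obtain ⟨p, hp⟩ := hne
    rw [← ringKrullDim_quotient_vanishP2_singleton p]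
    have hle : vanishP2 k X ≤ vanishP2 k {p} := by
      rw [vanishP2_eq_iInf]
      exact iInf_le _ (⟨p, hp⟩ : X)
    exact ringKrullDim_le_of_surjective (Ideal.Quotient.factor hle)
      (Ideal.Quotient.factor_surjective hle)

end Multicone

section RegularSequences

open MvPolynomial RingTheory.Sequence
open scoped Pointwise

lemma isSMulRegular_quotSMulTop_iff {A : Type*} [CommRing A] (a b : A) :
    IsSMulRegular (QuotSMulTop a A) b ↔ ∀ x y : A, b * x = a * y → ∃ z, x = a * z := by
  rw [isSMulRegular_iff_right_eq_zero_of_smul]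
  constructor
  · intro h x y hxy
    have := h (Submodule.Quotient.mk x) (by
      rw [← Submodule.Quotient.mk_smul, Submodule.Quotient.mk_eq_zero,
        Submodule.mem_smul_pointwise_iff_exists]
      exact ⟨y, trivial, by simpa using hxy.symm⟩)
    rw [Submodule.Quotient.mk_eq_zero, Submodule.mem_smul_pointwise_iff_exists] at this
    obtain ⟨z, -, hz⟩ := this
    exact ⟨z, by simpa using hz.symm⟩
  · intro h x hx
    obtain ⟨x, rfl⟩ := Submodule.Quotient.mk_surjective _ x
    rw [← Submodule.Quotient.mk_smul, Submodule.Quotient.mk_eq_zero,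
      Submodule.mem_smul_pointwise_iff_exists] at hx
    obtain ⟨y, -, hy⟩ := hx
    obtain ⟨z, hz⟩ := h x y (by simpa using hy.symm)
    rw [Submodule.Quotient.mk_eq_zero, Submodule.mem_smul_pointwise_iff_exists]
    exact ⟨z, trivial, by simpa using hz.symm⟩

variable {k} {σ : Type}

lemma IsACM.exists_regular_pair {I : Ideal (MvPolynomial σ k)} (h : IsACM I)
    (hdim : ringKrullDim (MvPolynomial σ k ⧸ I) = 2) :
    ∃ r₁ ∈ Ideal.span (Set.range (X : σ → MvPolynomial σ k)),
    ∃ r₂ ∈ Ideal.span (Set.range (X : σ → MvPolynomial σ k)),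
      (∀ f, r₁ * f ∈ I → f ∈ I) ∧ ∀ f g, r₂ * f - r₁ * g ∈ I → ∃ h, f - r₁ * h ∈ I := by
  obtain ⟨rs, hmem, hreg, hlen⟩ := h
  rw [hdim] at hlen
  have hlen : rs.length = 2 := by exact_mod_cast hlen
  obtain ⟨a, b, rfl⟩ := List.length_eq_two.1 hlen
  have hweak := hreg.toIsWeaklyRegular
  rw [isWeaklyRegular_cons_iff, isWeaklyRegular_singleton_iff, isSMulRegular_quotSMulTop_iff,
    isSMulRegular_iff_right_eq_zero_of_smul] at hweak
  obtain ⟨r₁, hr₁, rfl⟩ := (Ideal.mem_map_iff_of_surjective _ Ideal.Quotient.mk_surjective).1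
    (hmem a (by simp))
  obtain ⟨r₂, hr₂, rfl⟩ := (Ideal.mem_map_iff_of_surjective _ Ideal.Quotient.mk_surjective).1
    (hmem b (by simp))
  refine ⟨r₁, hr₁, r₂, hr₂, fun f hf => ?_, fun f g hfg => ?_⟩
  · rw [← Ideal.Quotient.eq_zero_iff_mem]
    apply hweak.1
    rwa [smul_eq_mul, ← map_mul, Ideal.Quotient.eq_zero_iff_mem]
  · obtain ⟨z, hz⟩ := hweak.2 (Ideal.Quotient.mk I f) (Ideal.Quotient.mk I g)
      (by rwa [← map_mul, ← map_mul, Ideal.Quotient.mk_eq_mk_iff_sub_mem])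
    obtain ⟨h, rfl⟩ := Ideal.Quotient.mk_surjective z
    exact ⟨h, by rwa [← map_mul, Ideal.Quotient.mk_eq_mk_iff_sub_mem] at hz⟩

lemma isACM_of_regular_pair {I : Ideal (MvPolynomial σ k)}
    (hI : I ≤ Ideal.span (Set.range (X : σ → MvPolynomial σ k)))
    (hdim : ringKrullDim (MvPolynomial σ k ⧸ I) = 2) {r₁ r₂ : MvPolynomial σ k}
    (hr₁ : r₁ ∈ Ideal.span (Set.range (X : σ → MvPolynomial σ k)))
    (hr₂ : r₂ ∈ Ideal.span (Set.range (X : σ → MvPolynomial σ k)))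
    (h₁ : ∀ f, r₁ * f ∈ I → f ∈ I) (h₂ : ∀ f g, r₂ * f - r₁ * g ∈ I → ∃ h, f - r₁ * h ∈ I) :
    IsACM I := by
  have hmem : ∀ r ∈ [Ideal.Quotient.mk I r₁, Ideal.Quotient.mk I r₂], r ∈
      Ideal.map (Ideal.Quotient.mk I) (Ideal.span (Set.range (X : σ → MvPolynomial σ k))) := by
    simp only [List.mem_cons, List.not_mem_nil, or_false, forall_eq_or_imp, forall_eq]
    exact ⟨Ideal.mem_map_of_mem _ hr₁, Ideal.mem_map_of_mem _ hr₂⟩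
  refine ⟨_, hmem, ⟨?_, ?_⟩, ?_⟩
  · rw [isWeaklyRegular_cons_iff, isWeaklyRegular_singleton_iff, isSMulRegular_quotSMulTop_iff,
      isSMulRegular_iff_right_eq_zero_of_smul]
    refine ⟨fun f hf => ?_, fun f g hfg => ?_⟩
    · obtain ⟨f, rfl⟩ := Ideal.Quotient.mk_surjective f
      rw [smul_eq_mul, ← map_mul, Ideal.Quotient.eq_zero_iff_mem] at hf
      rw [Ideal.Quotient.eq_zero_iff_mem]
      exact h₁ f hf
    · obtain ⟨f, rfl⟩ := Ideal.Quotient.mk_surjective f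
      obtain ⟨g, rfl⟩ := Ideal.Quotient.mk_surjective g
      rw [← map_mul, ← map_mul, Ideal.Quotient.mk_eq_mk_iff_sub_mem] at hfg
      obtain ⟨h, hh⟩ := h₂ f g hfg
      exact ⟨Ideal.Quotient.mk I h, by rwa [← map_mul, Ideal.Quotient.mk_eq_mk_iff_sub_mem]⟩
  · intro htop
    have hle : Ideal.ofList [Ideal.Quotient.mk I r₁, Ideal.Quotient.mk I r₂] ≤
        Ideal.map (Ideal.Quotient.mk I) (Ideal.span (Set.range (X : σ → MvPolynomial σ k))) :=
      Ideal.span_le.2 fun r hr => hmem r hr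
    rw [smul_eq_mul, Ideal.mul_top] at htop
    rw [← htop, top_le_iff, Ideal.eq_top_iff_one, ← map_one (Ideal.Quotient.mk I),
      Ideal.mem_map_iff_of_surjective _ Ideal.Quotient.mk_surjective] at hle
    obtain ⟨f, hf, hf1⟩ := hle
    rw [Ideal.Quotient.mk_eq_mk_iff_sub_mem] at hf1
    have h1 := Ideal.sub_mem _ hf (hI hf1)
    rw [sub_sub_cancel] at h1
    have hker : Ideal.span (Set.range (X : σ → MvPolynomial σ k)) ≤
        RingHom.ker (constantCoeff (σ := σ) (R := k)) := by
      rw [Ideal.span_le]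
      rintro _ ⟨i, rfl⟩
      simp [RingHom.mem_ker]
    simpa [RingHom.mem_ker] using hker h1
  · rw [hdim]
    rfl

/-- If two elements of `m` form a regular sequence modulo `⨅ i, J i`, a family `w` with
`m ^ a * w` in the image of the diagonal modulo the `J i` lies in that image itself. -/
lemma exists_of_pow_mul_mem {R ι : Type*} [CommRing R] {J : ι → Ideal R} {m : Ideal R}
    {r₁ r₂ : R} (hr₁ : r₁ ∈ m) (hr₂ : r₂ ∈ m) (h₁ : ∀ i f, r₁ * f ∈ J i → f ∈ J i)
    (h₂ : ∀ f g, r₂ * f - r₁ * g ∈ ⨅ i, J i → ∃ h, f - r₁ * h ∈ ⨅ i, J i) (a : ℕ) :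
    ∀ w : ι → R, (∀ q ∈ m ^ a, ∃ f, ∀ i, f - q * w i ∈ J i) → ∃ f, ∀ i, f - w i ∈ J i := by
  induction a with
  | zero =>
    intro w h
    simpa using h 1 (by simp)
  | succ a ih =>
    intro w h
    have key : ∀ r ∈ m, ∃ f, ∀ i, f - r * w i ∈ J i := by
      intro r hr
      apply ih
      intro q hq
      obtain ⟨f, hf⟩ := h (q * r) (by rw [pow_succ]; exact Ideal.mul_mem_mul hq hr)
      exact ⟨f, fun i => by rw [← mul_assoc]; exact hf i⟩
    obtain ⟨f₁, hf₁⟩ := key r₁ hr₁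
    obtain ⟨f₂, hf₂⟩ := key r₂ hr₂
    obtain ⟨g, hg⟩ := h₂ f₁ f₂ (by
      rw [Ideal.mem_iInf]
      intro i
      have := Ideal.sub_mem _ (Ideal.mul_mem_left _ r₂ (hf₁ i)) (Ideal.mul_mem_left _ r₁ (hf₂ i))
      convert this using 1
      ring)
    rw [Ideal.mem_iInf] at hg
    refine ⟨g, fun i => h₁ i _ ?_⟩
    have := Ideal.sub_mem _ (hf₁ i) (hg i)
    convert this using 1
    ring

end RegularSequences

section Levels

open MvPolynomial

variable {k} {n : ℕ} {X : Set (Pt k 1 × Pt k n)}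

lemma mem_vanishP2_level {P : Pt k 1} {f : MvPolynomial (Fin (1 + 1) ⊕ Fin (n + 1)) k} :
    f ∈ vanishP2 k {p ∈ X | p.1 = P} ↔ ∀ Q, (P, Q) ∈ X → ∀ s t : k,
      eval (Sum.elim (s • P.rep) (t • Q.rep)) f = 0 := by
  rw [mem_vanishP2]
  constructor
  · exact fun h Q hQ => h P Q ⟨hQ, rfl⟩
  · rintro h P Q ⟨hQ, rfl⟩
    exact h Q hQ

lemma vanishP2_eq_iInf_level : vanishP2 k X = ⨅ P, vanishP2 k {p ∈ X | p.1 = P} := by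
  ext f
  rw [Ideal.mem_iInf, mem_vanishP2]
  exact forall_congr' fun P => mem_vanishP2_level.symm

/-- A nonzerodivisor modulo the ideal of `X` is a nonzerodivisor modulo the ideal of each level
set. -/
lemma mem_vanishP2_level_of_mul_mem [Infinite k] (hfin : X.Finite)
    {r : MvPolynomial (Fin (1 + 1) ⊕ Fin (n + 1)) k}
    (hr : ∀ f, r * f ∈ vanishP2 k X → f ∈ vanishP2 k X) (P : Pt k 1)
    {f : MvPolynomial (Fin (1 + 1) ⊕ Fin (n + 1)) k}
    (hf : r * f ∈ vanishP2 k {p ∈ X | p.1 = P}) : f ∈ vanishP2 k {p ∈ X | p.1 = P} := by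
  classical
  obtain ⟨L, b, c, hc, hL, hL0⟩ :=
    exists_separator (Fin (n + 1)) (hfin.image Prod.fst).toFinset P
  have hLf : L * f ∈ vanishP2 k X := by
    apply hr
    rw [mem_vanishP2]
    intro P' Q hQ s t
    by_cases hP : P' = P
    · subst hP
      have := mem_vanishP2_level.1 hf Q hQ s t
      rw [← mul_assoc, mul_comm r, mul_assoc, map_mul, this, mul_zero]
    · rw [map_mul, map_mul, hL0 P' (by simpa using ⟨Q, hQ⟩) hP]
      ring
  rw [mem_vanishP2_level]
  intro Q hQ s t
  apply eval_eq_zero_of_forall_ne_zero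
  intro s hs
  have := mem_vanishP2.1 hLf P Q hQ s t
  rw [map_mul, hL] at this
  exact (mul_eq_zero.1 this).resolve_left (mul_ne_zero (pow_ne_zero _ hs) hc)

lemma eval_rename_inr {σ τ : Type} (x : σ → k) (y : τ → k) (u : MvPolynomial τ k) :
    eval (Sum.elim x y) (rename Sum.inr u) = eval y u := by
  rw [eval_rename, Sum.elim_comp_inr]

open Classical in
/-- If `X` is ACM, every form `u` on the level over `P₀` which vanishes on `B_Y` lifts, after
extension by zero to the other levels, to a form on `ℙ^n`. -/
lemma IsACM.exists_form [Infinite k] (hfin : X.Finite) (hn : 1 ≤ n) (hACM : IsACM (vanishP2 k X))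
    (hgen : GenericHF k (Prod.snd '' X)) {P₀ : Pt k 1}
    (hint : ∀ P ∈ Prod.fst '' X, P₀ ≠ P → levelImage k X P₀ ∩ levelImage k X P ⊆ BY k X)
    {d : ℕ} {u : MvPolynomial (Fin (n + 1)) k} (hu : u.IsHomogeneous d)
    (huB : ∀ Q ∈ BY k X, eval Q.rep u = 0) :
    ∃ h : MvPolynomial (Fin (n + 1)) k, h.IsHomogeneous d ∧ ∀ P Q, (P, Q) ∈ X →
      eval Q.rep h = if P = P₀ then eval Q.rep u else 0 := by
  rcases X.eq_empty_or_nonempty with rfl | hne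
  · exact ⟨0, isHomogeneous_zero _ _ _, by simp⟩
  obtain ⟨r₁, hr₁, r₂, hr₂, h₁, h₂⟩ :=
    hACM.exists_regular_pair (ringKrullDim_quotient_vanishP2 hfin hne)
  let J : Pt k 1 → Ideal (MvPolynomial (Fin (1 + 1) ⊕ Fin (n + 1)) k) :=
    fun P => vanishP2 k {p ∈ X | p.1 = P}
  let w : Pt k 1 → MvPolynomial (Fin (1 + 1) ⊕ Fin (n + 1)) k :=
    fun P => if P = P₀ then rename Sum.inr u else 0
  let T : Ideal (MvPolynomial (Fin (1 + 1) ⊕ Fin (n + 1)) k) :=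
    { carrier := {q | ∃ f, ∀ P, f - q * w P ∈ J P}
      zero_mem' := ⟨0, by simp⟩
      add_mem' := by
        rintro q q' ⟨f, hf⟩ ⟨f', hf'⟩
        refine ⟨f + f', fun P => ?_⟩
        have := Ideal.add_mem _ (hf P) (hf' P)
        convert this using 1
        ring
      smul_mem' := by
        rintro c q ⟨f, hf⟩
        refine ⟨c * f, fun P => ?_⟩
        have := Ideal.mul_mem_left _ c (hf P)
        convert this using 1
        rw [smul_eq_mul]
        ring }
  have hT : ∀ q, (∃ f, ∀ P Q, (P, Q) ∈ X → ∀ s t : k,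
      eval (Sum.elim (s • P.rep) (t • Q.rep)) f =
        if P = P₀ then eval (Sum.elim (s • P.rep) (t • Q.rep)) q * eval (t • Q.rep) u
        else 0) → q ∈ T := by
    rintro q ⟨f, hf⟩
    refine ⟨f, fun P => mem_vanishP2_level.2 fun Q hQ s t => ?_⟩
    rw [map_sub, map_mul, hf P Q hQ]
    simp only [w]
    split_ifs
    · rw [eval_rename_inr, sub_self]
    · simp
  obtain ⟨a, ha⟩ : ∃ a, Ideal.span (Set.range (MvPolynomial.X :
      Fin (1 + 1) ⊕ Fin (n + 1) → MvPolynomial _ k)) ^ a ≤ T := by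
    apply Ideal.exists_pow_le_of_le_radical_of_fg _
      (Submodule.fg_span (Set.finite_range _))
    rw [Ideal.span_le]
    rintro _ ⟨l | l, rfl⟩
    · obtain ⟨L, b, c, hc, hL, hL0⟩ :=
        exists_separator (Fin (n + 1)) (hfin.image Prod.fst).toFinset P₀
      refine ⟨b, hT _ ⟨C (P₀.rep l ^ b * c⁻¹) * L * rename Sum.inr u, fun P Q hQ s t => ?_⟩⟩
      rw [map_mul, map_mul, eval_C, eval_rename_inr]
      split_ifs with hP
      · subst hP
        rw [hL, map_pow, eval_X, Sum.elim_inl, Pi.smul_apply, smul_eq_mul, mul_pow]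
        field_simp
      · rw [hL0 P (by simpa using ⟨Q, hQ⟩) hP]
        ring
    · obtain ⟨e, he⟩ : ∃ e, (Prod.snd '' X).ncard ≤ (d + e + n).choose n := by
        refine ⟨(Prod.snd '' X).ncard, ?_⟩
        calc (Prod.snd '' X).ncard ≤ (d + (Prod.snd '' X).ncard + 1).choose 1 := by
              rw [Nat.choose_one_right]; omega
          _ = (d + (Prod.snd '' X).ncard + 1).choose (d + (Prod.snd '' X).ncard) := by
              rw [← Nat.choose_symm_add]
          _ ≤ (d + (Prod.snd '' X).ncard + n).choose (d + (Prod.snd '' X).ncard) :=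
              Nat.choose_le_choose _ (by omega)
          _ = _ := Nat.choose_symm_add
      obtain ⟨F, hF, hFc⟩ := hgen.exists_form (hfin.image _) he
        (fun Q => if (P₀, Q) ∈ X then Q.rep l ^ e * eval Q.rep u else 0)
      refine ⟨e, hT _ ⟨rename Sum.inr F, fun P Q hQ s t => ?_⟩⟩
      rw [eval_rename_inr, hF.eval_smul', hFc Q ⟨_, hQ, rfl⟩]
      split_ifs with hQ₀ hP hP
      · rw [map_pow, eval_X, Sum.elim_inr, Pi.smul_apply, smul_eq_mul, hu.eval_smul']
        ring
      · rw [huB Q (hint P ⟨_, hQ, rfl⟩ (Ne.symm hP) ⟨hQ₀, hQ⟩)]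
        ring
      · subst hP
        exact absurd hQ hQ₀
      · rw [mul_zero]
  obtain ⟨h, hh⟩ := exists_of_pow_mul_mem (J := J) hr₁ hr₂
    (fun P f hf => mem_vanishP2_level_of_mul_mem hfin h₁ P hf)
    (by simp only [J]; rw [← vanishP2_eq_iInf_level]; exact h₂) a w (fun q hq => ha hq)
  have hval : ∀ P Q, (P, Q) ∈ X → ∀ t : k, eval (Sum.elim 0 (t • Q.rep)) h =
      t ^ d * if P = P₀ then eval Q.rep u else 0 := by
    intro P Q hQ t
    have := mem_vanishP2_level.1 (hh P) Q hQ 0 t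
    rw [map_sub, sub_eq_zero, zero_smul] at this
    rw [this]
    simp only [w]
    split_ifs
    · rw [eval_rename_inr, hu.eval_smul']
    · simp
  let H : MvPolynomial (Fin (n + 1)) k := aeval (Sum.elim 0 MvPolynomial.X) h
  have hH : ∀ y, eval y H = eval (Sum.elim 0 y) h := by
    intro y
    simp only [H]
    rw [eval_aeval_eq]
    congr 2
    ext (i | i) <;> simp
  refine ⟨weightedHomogeneousComponent 1 d H,
    weightedHomogeneousComponent_isWeightedHomogeneous d H, fun P Q hQ => ?_⟩
  rw [← coeff_weightedLine]
  have hline : weightedLine 1 Q.rep H =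
      Polynomial.C (if P = P₀ then eval Q.rep u else 0) * Polynomial.X ^ d := by
    apply Polynomial.funext
    intro t
    rw [eval_weightedLine, Polynomial.eval_mul, Polynomial.eval_C, Polynomial.eval_X_pow, mul_comm,
      ← hval P Q hQ t, hH]
    congr 3
    ext i
    simp
  rw [hline, Polynomial.coeff_C_mul_X_pow, if_pos rfl]

end Levels

section RegularPair

open MvPolynomial

variable {k} {n : ℕ} {X : Set (Pt k 1 × Pt k n)}

lemma isHomogeneous_aeval_inl {σ τ : Type} (x : σ → k) {f : MvPolynomial (σ ⊕ τ) k} {d : ℕ}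
    (hf : f.IsWeightedHomogeneous (Sum.elim 0 1) d) :
    (aeval (Sum.elim (fun i => C (x i)) MvPolynomial.X) f : MvPolynomial τ k).IsHomogeneous d := by
  rw [f.as_sum, map_sum]
  refine IsHomogeneous.sum _ _ _ fun e he => ?_
  rw [aeval_monomial, ← hf (mem_support_iff.1 he), Finsupp.weight_apply,
    ← zero_add (Finsupp.sum _ _)]
  refine (isHomogeneous_C _ _).mul (IsHomogeneous.prod _ _ _ fun i _ => ?_)
  rcases i with i | i
  · simpa using (isHomogeneous_C τ (x i)).pow (e (Sum.inl i))
  · simpa using (isHomogeneous_X k i).pow (e (Sum.inr i))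

lemma vanishP2_le_span_range_X {a b : ℕ} {X : Set (Pt k a × Pt k b)} (hne : X.Nonempty) :
    vanishP2 k X ≤ Ideal.span (Set.range
      (MvPolynomial.X : Fin (a + 1) ⊕ Fin (b + 1) → MvPolynomial _ k)) := by
  intro f hf
  obtain ⟨⟨P, Q⟩, hp⟩ := hne
  have h0 := mem_vanishP2.1 hf P Q hp 0 0
  have hz : Sum.elim ((0 : k) • P.rep) ((0 : k) • Q.rep) = 0 := by
    ext (i | i) <;> simp
  rw [hz, eval_zero] at h0
  rw [← pow_one (Ideal.span _), mem_pow_idealOfVars_iff']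
  intro x hx
  rw [(Finsupp.degree_eq_zero_iff x).1 (Nat.lt_one_iff.1 hx)]
  exact h0

/-- A sufficient criterion for `X` to be ACM: in each degree `d` there is a set `Z` of points
imposing independent conditions on forms of degree `d`, such that on every level a form of
degree `d` vanishing on the part of `Z` in the level vanishes on the whole level. -/
lemma isACM_of_exists_basis [Infinite k] (hfin : X.Finite) (hne : X.Nonempty)
    (hbasis : ∀ d : ℕ, ∃ (Z : Finset (Pt k n)) (e : Pt k n → MvPolynomial (Fin (n + 1)) k),
      (∀ Q ∈ Z, (e Q).IsHomogeneous d ∧ eval Q.rep (e Q) = 1 ∧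
        ∀ Q' ∈ Z, Q' ≠ Q → eval Q'.rep (e Q) = 0) ∧ (Z : Set (Pt k n)) ⊆ Prod.snd '' X ∧
      ∀ P, ∀ u : MvPolynomial (Fin (n + 1)) k, u.IsHomogeneous d →
        (∀ Q ∈ Z, (P, Q) ∈ X → eval Q.rep u = 0) → ∀ Q, (P, Q) ∈ X → eval Q.rep u = 0) :
    IsACM (vanishP2 k X) := by
  classical
  obtain ⟨α, hα⟩ := exists_linear_form_ne_zero (hfin.image Prod.fst)
  obtain ⟨β, hβ⟩ := exists_linear_form_ne_zero (hfin.image Prod.snd)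
  let ℓx : MvPolynomial (Fin (1 + 1) ⊕ Fin (n + 1)) k := ∑ i, C (α i) * MvPolynomial.X (Sum.inl i)
  let ℓy : MvPolynomial (Fin (1 + 1) ⊕ Fin (n + 1)) k := ∑ i, C (β i) * MvPolynomial.X (Sum.inr i)
  have hℓx : ∀ (x : Fin (1 + 1) → k) (y : Fin (n + 1) → k),
      eval (Sum.elim x y) ℓx = ∑ i, α i * x i := by
    intro x y; simp [ℓx]
  have hℓy : ∀ (x : Fin (1 + 1) → k) (y : Fin (n + 1) → k),
      eval (Sum.elim x y) ℓy = ∑ i, β i * y i := by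
    intro x y; simp [ℓy]
  have hsmul : ∀ {m : ℕ} (c v : Fin m → k) (s : k),
      ∑ i, c i * (s • v) i = s * ∑ i, c i * v i := by
    intro m c v s
    rw [Finset.mul_sum]
    refine Finset.sum_congr rfl fun i _ => ?_
    rw [Pi.smul_apply, smul_eq_mul]
    ring
  refine isACM_of_regular_pair (vanishP2_le_span_range_X hne)
    (ringKrullDim_quotient_vanishP2 hfin hne) (r₁ := ℓx) (r₂ := ℓy)
    (Ideal.sum_mem _ fun i _ => Ideal.mul_mem_left _ _ (Ideal.subset_span ⟨_, rfl⟩))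
    (Ideal.sum_mem _ fun i _ => Ideal.mul_mem_left _ _ (Ideal.subset_span ⟨_, rfl⟩)) ?_ ?_
  · intro f hf
    rw [mem_vanishP2] at hf ⊢
    intro P Q hQ s t
    apply eval_eq_zero_of_forall_ne_zero
    intro s hs
    have := hf P Q hQ s t
    rw [map_mul, hℓx, hsmul] at this
    exact (mul_eq_zero.1 this).resolve_left (mul_ne_zero hs (hα P ⟨_, hQ, rfl⟩))
  · intro f g hfg
    have hcoeff : ∀ P Q, (P, Q) ∈ X → ∀ (s : k) (d : ℕ),
        (∑ i, β i * Q.rep i) * eval (Sum.elim (s • P.rep) Q.rep)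
          (weightedHomogeneousComponent (Sum.elim 0 1 : Fin (1 + 1) ⊕ Fin (n + 1) → ℕ) d f) =
        (s * ∑ i, α i * P.rep i) * eval (Sum.elim (s • P.rep) Q.rep)
          (weightedHomogeneousComponent
            (Sum.elim 0 1 : Fin (1 + 1) ⊕ Fin (n + 1) → ℕ) (d + 1) g) := by
      intro P Q hQ s d
      have hpoly : Polynomial.C (∑ i, β i * Q.rep i) *
            (Polynomial.X * weightedLine (Sum.elim 0 1) (Sum.elim (s • P.rep) Q.rep) f) =
          Polynomial.C (s * ∑ i, α i * P.rep i) *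
            weightedLine (Sum.elim 0 1) (Sum.elim (s • P.rep) Q.rep) g := by
        apply Polynomial.funext
        intro t
        have := mem_vanishP2.1 hfg P Q hQ s t
        rw [map_sub, map_mul, map_mul, hℓx, hℓy, hsmul, hsmul, sub_eq_zero] at this
        have hpt : (fun i => t ^ (Sum.elim 0 1 : Fin (1 + 1) ⊕ Fin (n + 1) → ℕ) i *
            Sum.elim (s • P.rep) Q.rep i) = Sum.elim (s • P.rep) (t • Q.rep) := by
          ext (i | i) <;> simp
        rw [Polynomial.eval_mul, Polynomial.eval_mul, Polynomial.eval_mul, Polynomial.eval_C,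
          Polynomial.eval_C, Polynomial.eval_X, eval_weightedLine, eval_weightedLine, hpt, ← this]
        ring
      have := congrArg (fun p => Polynomial.coeff p (d + 1)) hpoly
      simpa only [Polynomial.coeff_C_mul, Polynomial.coeff_X_mul, coeff_weightedLine] using this
    have hcomp : ∀ d, ∃ h,
        weightedHomogeneousComponent (Sum.elim 0 1 : Fin (1 + 1) ⊕ Fin (n + 1) → ℕ) d f -
          ℓx * h ∈ vanishP2 k X := by
      intro d
      obtain ⟨Z, e, he, hZX, hZ⟩ := hbasis d
      let fd := weightedHomogeneousComponent (Sum.elim 0 1 : Fin (1 + 1) ⊕ Fin (n + 1) → ℕ) d f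
      let gd := weightedHomogeneousComponent
        (Sum.elim 0 1 : Fin (1 + 1) ⊕ Fin (n + 1) → ℕ) (d + 1) g
      let gQ : Pt k n → MvPolynomial (Fin (1 + 1) ⊕ Fin (n + 1)) k := fun Q =>
        aeval (Sum.elim (fun i => MvPolynomial.X (Sum.inl i)) fun i => C (Q.rep i)) gd
      have hgQ : ∀ Q x y, eval (Sum.elim x y) (gQ Q) = eval (Sum.elim x Q.rep) gd := by
        intro Q x y
        simp only [gQ]
        rw [eval_aeval_eq]
        congr 2
        ext (i | i) <;> simp
      refine ⟨∑ Q ∈ Z, C (∑ i, β i * Q.rep i)⁻¹ * gQ Q * rename Sum.inr (e Q), ?_⟩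
      rw [mem_vanishP2]
      intro P Q hQ s t
      let κ : Pt k n → k := fun Q => (s * ∑ i, α i * P.rep i) * ((∑ i, β i * Q.rep i)⁻¹ *
        eval (Sum.elim (s • P.rep) Q.rep) gd)
      let D : MvPolynomial (Fin (n + 1)) k :=
        aeval (Sum.elim (fun i => C ((s • P.rep) i)) MvPolynomial.X) fd - ∑ Q ∈ Z, C (κ Q) * e Q
      have hD : D.IsHomogeneous d := by
        refine (isHomogeneous_aeval_inl _
          (weightedHomogeneousComponent_isWeightedHomogeneous d f)).sub
          (IsHomogeneous.sum _ _ _ fun Q hQ => ?_)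
        simpa using (isHomogeneous_C _ (κ Q)).mul (he Q hQ).1
      have heval : ∀ y, eval y D = eval (Sum.elim (s • P.rep) y) fd -
          ∑ Q ∈ Z, κ Q * eval y (e Q) := by
        intro y
        simp only [D]
        rw [map_sub, eval_aeval_eq, map_sum]
        congr 1
        · congr 2
          ext (i | i) <;> simp
        · simp
      have hDe : ∀ y, eval (Sum.elim (s • P.rep) y) (fd -
          ℓx * ∑ Q ∈ Z, C (∑ i, β i * Q.rep i)⁻¹ * gQ Q * rename Sum.inr (e Q)) = eval y D := by
        intro y
        rw [heval, map_sub, map_mul, hℓx, hsmul, map_sum, Finset.mul_sum]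
        congr 1
        refine Finset.sum_congr rfl fun Q _ => ?_
        rw [map_mul, map_mul, eval_C, hgQ, eval_rename_inr]
        ring
      rw [hDe, hD.eval_smul', hZ P D hD ?_ Q hQ, mul_zero]
      intro Q hQZ hQ
      rw [heval, Finset.sum_eq_single_of_mem Q hQZ, (he Q hQZ).2.1]
      · have h1 := hcoeff P Q hQ s d
        have h2 := hβ Q ⟨_, hQ, rfl⟩
        simp only [κ, fd, gd]
        field_simp
        linear_combination h1
      · intro Q' hQ'Z hne
        rw [(he Q' hQ'Z).2.2 Q hQZ hne.symm, mul_zero]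
    choose h hh using hcomp
    have hsupp := weightedHomogeneousComponent_finsupp
      (w := (Sum.elim 0 1 : Fin (1 + 1) ⊕ Fin (n + 1) → ℕ)) f
    have hsum := sum_weightedHomogeneousComponent
      (Sum.elim 0 1 : Fin (1 + 1) ⊕ Fin (n + 1) → ℕ) f
    rw [finsum_eq_sum _ hsupp] at hsum
    refine ⟨∑ d ∈ hsupp.toFinset, h d, ?_⟩
    nth_rewrite 1 [← hsum]
    rw [Finset.mul_sum, ← Finset.sum_sub_distrib]
    exact Ideal.sum_mem _ fun d _ => hh d

end RegularPair

section Counting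

open MvPolynomial

variable {k} {n : ℕ} {X : Set (Pt k 1 × Pt k n)}

lemma image_snd_BX (hne : X.Nonempty) : Prod.snd '' BX k X = BY k X := by
  ext Q
  constructor
  · rintro ⟨p, hp, rfl⟩
    exact hp.2
  · intro hQ
    obtain ⟨p, hp⟩ := hne
    exact ⟨(p.1, Q), ⟨hQ p.1 ⟨p, hp, rfl⟩, hQ⟩, rfl⟩

lemma image_snd_AX_union_BY (hne : X.Nonempty) :
    Prod.snd '' AX k X ∪ BY k X = Prod.snd '' X := by
  rw [← image_snd_BX hne, ← Set.image_union, AX, Set.sdiff_union_of_subset fun p hp => hp.1]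

lemma N1_eq_ncard_BY (hne : X.Nonempty) : N1 k X = (BY k X).ncard := by
  rw [N1, image_snd_BX hne]

lemma ncard_image_snd (hfin : X.Finite) (hne : X.Nonempty) :
    (Prod.snd '' X).ncard = N1 k X + N0 k X := by
  have hdisj : Disjoint (Prod.snd '' AX k X) (Prod.snd '' BX k X) := by
    rw [Set.disjoint_left, image_snd_BX hne]
    rintro _ ⟨p, hp, rfl⟩ hQ
    exact hp.2 ⟨hp.1, hQ⟩
  rw [← image_snd_AX_union_BY hne, ← image_snd_BX hne, Set.ncard_union_eq hdisj
    ((hfin.subset Set.sdiff_subset).image _) ((hfin.subset fun p hp => hp.1).image _), N0, N1,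
    add_comm]

lemma exists_choose_le_lt {n : ℕ} (hn : 1 ≤ n) (N : ℕ) :
    ∃ j : ℕ, j.choose n ≤ N ∧ N < (j + 1).choose n := by
  have hex : ∃ m : ℕ, N < m.choose n := by
    refine ⟨N + n, ?_⟩
    rw [← Nat.choose_symm_add]
    calc N < (N + 1).choose N := by simp
      _ ≤ (N + n).choose N := Nat.choose_le_choose N (by lia)
  have hpos : Nat.find hex ≠ 0 := by
    intro h0
    have := Nat.find_spec hex
    rw [h0, Nat.choose_eq_zero_of_lt hn] at this
    exact Nat.not_lt_zero _ this
  obtain ⟨j, hj⟩ := Nat.exists_eq_succ_of_ne_zero hpos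
  refine ⟨j, not_lt.1 (Nat.find_min hex (by lia)), ?_⟩
  have := Nat.find_spec hex
  rwa [hj] at this

/-- If `X` is ACM, then no number `dim_k k[y_0, …, y_n]_d` lies strictly between `N₁(X)` and
`N₁(X) + N₀(X)`. -/
lemma IsACM.choose_le_or_le [Infinite k] (hfin : X.Finite) (hn : 1 ≤ n)
    (hninc : ¬ InclusionProp k X)
    (hgen : ∀ Z : Set (Pt k n), Z ⊆ Prod.snd '' X → GenericHF k Z)
    (hint : ∀ P₁ ∈ Prod.fst '' X, ∀ P₂ ∈ Prod.fst '' X, P₁ ≠ P₂ →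
      levelImage k X P₁ ∩ levelImage k X P₂ ⊆ BY k X)
    (hACM : IsACM (vanishP2 k X)) (d : ℕ) :
    (d + n).choose n ≤ N1 k X ∨ N1 k X + N0 k X ≤ (d + n).choose n := by
  classical
  by_contra! hcon
  obtain ⟨hlt₁, hlt₂⟩ := hcon
  simp only [InclusionProp, not_forall, not_or, Set.not_subset] at hninc
  obtain ⟨P₁, P₂, ⟨Q₁, hQ₁, hQ₁'⟩, ⟨Q₂, hQ₂, hQ₂'⟩⟩ := hninc
  have hne : X.Nonempty := ⟨_, hQ₁⟩
  have hP₁ : P₁ ∈ Prod.fst '' X := ⟨_, hQ₁, rfl⟩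
  have hP₂ : P₂ ∈ Prod.fst '' X := ⟨_, hQ₂, rfl⟩
  have hY : (Prod.snd '' X).Finite := hfin.image _
  have hlevel : ∀ P, levelImage k X P ⊆ Prod.snd '' X := fun P Q hQ => ⟨(P, Q), hQ, rfl⟩
  have hBY : BY k X ⊆ Prod.snd '' X := fun Q hQ => ⟨_, hQ _ hP₁, rfl⟩
  rw [← ncard_image_snd hfin hne] at hlt₂
  rw [N1_eq_ncard_BY hne] at hlt₁
  by_cases hbig : ∃ P ∈ Prod.fst '' X, (d + n).choose n ≤ (levelImage k X P).ncard
  · obtain ⟨P, hP, hcard⟩ := hbig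
    obtain ⟨P', hP', hPP', Q, hQ, hQB⟩ :
        ∃ P' ∈ Prod.fst '' X, P ≠ P' ∧ ∃ Q, (P', Q) ∈ X ∧ Q ∉ BY k X := by
      by_cases h : P = P₁
      · refine ⟨P₂, hP₂, ?_, Q₂, hQ₂, fun hB => hQ₂' (hB P₁ hP₁)⟩
        rintro rfl
        subst h
        exact hQ₁' hQ₁
      · exact ⟨P₁, hP₁, h, Q₁, hQ₁, fun hB => hQ₁' (hB P₂ hP₂)⟩
    have hsub : insert Q (BY k X) ⊆ Prod.snd '' X := Set.insert_subset ⟨_, hQ, rfl⟩ hBY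
    obtain ⟨u, hu, hval⟩ := (hgen _ hsub).exists_form (d := d) (hY.subset hsub)
      (by rw [Set.ncard_insert_of_notMem hQB (hY.subset hBY)]; exact hlt₁) (Pi.single Q 1)
    obtain ⟨h, hh, hhX⟩ := hACM.exists_form hfin hn (hgen _ subset_rfl) (hint P' hP') hu
      fun Q' hQ' => by
        rw [hval Q' (Set.mem_insert_of_mem _ hQ'), Pi.single_eq_of_ne]
        rintro rfl
        exact hQB hQ'
    have h0 := (hgen _ (hlevel P)).eval_eq_zero_of_subset (hgen _ subset_rfl) hY (hlevel P)
      hcard hh (fun q hq => by rw [hhX P q hq, if_neg hPP']) Q ⟨_, hQ, rfl⟩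
    rw [hhX P' Q hQ, if_pos rfl, hval Q (Set.mem_insert _ _), Pi.single_eq_same] at h0
    exact one_ne_zero h0
  · push Not at hbig
    obtain ⟨u, hu, hval⟩ := (hgen _ (hlevel P₁)).exists_form (hY.subset (hlevel P₁))
      (hbig P₁ hP₁).le (Pi.single Q₁ 1)
    obtain ⟨h, hh, hhX⟩ := hACM.exists_form hfin hn (hgen _ subset_rfl) (hint P₁ hP₁) hu
      fun Q' hQ' => by
        rw [hval Q' (hQ' P₁ hP₁), Pi.single_eq_of_ne]
        rintro rfl
        exact hQ₁' (hQ' P₂ hP₂)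
    have hsub : Prod.snd '' X \ {Q₁} ⊆ Prod.snd '' X := Set.sdiff_subset
    have h0 := (hgen _ hsub).eval_eq_zero_of_subset (hgen _ subset_rfl) hY hsub
      (by rw [Set.ncard_sdiff_singleton_of_mem (hlevel P₁ hQ₁)]; lia) hh
      (by
        rintro _ ⟨⟨⟨P, Q⟩, hPQ, rfl⟩, hQ⟩
        rw [hhX P Q hPQ]
        split_ifs with hPP
        · subst hPP
          rw [hval Q hPQ, Pi.single_eq_of_ne hQ]
        · rfl) Q₁ ⟨_, hQ₁, rfl⟩
    rw [hhX P₁ Q₁ hQ₁, if_pos rfl, hval Q₁ hQ₁, Pi.single_eq_same] at h0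
    exact one_ne_zero h0

/-- If no number `dim_k k[y_0, …, y_n]_d` lies strictly between `N₁(X)` and `N₁(X) + N₀(X)`,
then `X` is ACM. -/
lemma isACM_of_choose_le_or_le [Infinite k] (hfin : X.Finite) (hne : X.Nonempty)
    (hgen : ∀ Z : Set (Pt k n), Z ⊆ Prod.snd '' X → GenericHF k Z)
    (hchoose : ∀ d : ℕ, (d + n).choose n ≤ N1 k X ∨ N1 k X + N0 k X ≤ (d + n).choose n) :
    IsACM (vanishP2 k X) := by
  classical
  have hY : (Prod.snd '' X).Finite := hfin.image _
  have hlevel : ∀ P, levelImage k X P ⊆ Prod.snd '' X := fun P Q hQ => ⟨(P, Q), hQ, rfl⟩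
  refine isACM_of_exists_basis hfin hne fun d => ?_
  obtain ⟨Z, hZX, hZd, hZ⟩ : ∃ Z ⊆ Prod.snd '' X, Z.ncard ≤ (d + n).choose n ∧
      ∀ P, ∀ u : MvPolynomial (Fin (n + 1)) k, u.IsHomogeneous d →
        (∀ Q ∈ Z, (P, Q) ∈ X → eval Q.rep u = 0) → ∀ Q, (P, Q) ∈ X → eval Q.rep u = 0 := by
    rcases hchoose d with hd | hd
    · rw [N1_eq_ncard_BY hne] at hd
      obtain ⟨Z, hZB, hZd⟩ := Set.exists_subset_card_eq hd
      have hZP : ∀ P Q, (P, Q) ∈ X → Z ⊆ levelImage k X P :=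
        fun P Q hQ Q' hQ' => hZB hQ' P ⟨_, hQ, rfl⟩
      obtain ⟨p, hp⟩ := hne
      refine ⟨Z, (hZP p.1 p.2 hp).trans (hlevel _), hZd.le, fun P u hu h0 Q hQ => ?_⟩
      have hZX := (hZP P Q hQ).trans (hlevel _)
      exact (hgen Z hZX).eval_eq_zero_of_subset (hgen _ subset_rfl) hY hZX hZd.ge hu
        (fun Q' hQ' => h0 Q' hQ' (hZP P Q hQ hQ')) Q ⟨_, hQ, rfl⟩
    · rw [← ncard_image_snd hfin hne] at hd
      exact ⟨_, subset_rfl, hd, fun P u _ h0 Q hQ => h0 Q ⟨_, hQ, rfl⟩ hQ⟩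
  have hZfin := hY.subset hZX
  choose e he hval using fun Q : Pt k n =>
    (hgen Z hZX).exists_form hZfin hZd (Pi.single Q 1)
  refine ⟨hZfin.toFinset, e, fun Q hQ => ⟨he Q, ?_, fun Q' hQ' hne => ?_⟩, ?_, ?_⟩
  · rw [hval Q Q (hZfin.mem_toFinset.1 hQ), Pi.single_eq_same]
  · rw [hval Q Q' (hZfin.mem_toFinset.1 hQ'), Pi.single_eq_of_ne hne]
  · rwa [hZfin.coe_toFinset]
  · simpa only [hZfin.mem_toFinset] using hZ

end Counting

/-- **Theorem (no intersections outside `B_Y`).** Let `X ⊆ ℙ^1 × ℙ^n`, `n ≥ 2`, be a finite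
set of points without the inclusion property, such that the points of `π₁(A_X)` and of
`B_Y = π₁(B_X)` are generic in `ℙ^n` (every subset of `π₁(A_X) ∪ B_Y` has generic Hilbert
function), and assume `Y_i ∩ Y_j ⊆ B_Y` for all `i ≠ j`.  Then `X` is ACM if and only if
`N₁(X) ∈ 𝒟(X)`. -/
theorem acm_iff_N1_mem_D [CharZero k] {n : ℕ} (hn : 2 ≤ n) (X : Set (Pt k 1 × Pt k n))
    (hfin : X.Finite) (hninc : ¬ InclusionProp k X)
    (hgen : ∀ Z : Set (Pt k n), Z ⊆ Prod.snd '' AX k X ∪ BY k X → GenericHF k Z)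
    (hint : ∀ P₁ ∈ Prod.fst '' X, ∀ P₂ ∈ Prod.fst '' X, P₁ ≠ P₂ →
      levelImage k X P₁ ∩ levelImage k X P₂ ⊆ BY k X) :
    IsACM (vanishP2 k X) ↔ N1 k X ∈ DX k X := by
  have hne : X.Nonempty := by
    by_contra hX
    rw [Set.not_nonempty_iff_eq_empty] at hX
    subst hX
    exact hninc fun P₁ P₂ => Or.inl fun Q hQ => absurd hQ (Set.notMem_empty _)
  rw [image_snd_AX_union_BY hne] at hgen
  constructor
  · intro hACM
    obtain ⟨j, hj, hj'⟩ := exists_choose_le_lt (by lia : 1 ≤ n) (N1 k X)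
    refine ⟨j, hj, ?_⟩
    have hnj : n ≤ j + 1 := by
      by_contra! h
      rw [Nat.choose_eq_zero_of_lt h] at hj'
      exact Nat.not_lt_zero _ hj'
    have := hACM.choose_le_or_le hfin (by lia) hninc hgen hint (j + 1 - n)
    rw [Nat.sub_add_cancel hnj] at this
    exact this.resolve_left (not_le.2 hj')
  · rintro ⟨j, hj, hj'⟩
    refine isACM_of_choose_le_or_le hfin hne hgen fun d => ?_
    rcases le_or_gt (d + n) j with hd | hd
    · exact Or.inl ((Nat.choose_le_choose n hd).trans hj)
    · exact Or.inr (hj'.trans (Nat.choose_le_choose n hd))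

end
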